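/- arXiv:1109.6180 — 2 statements merged into one kernel-verified Lean document; each statement's English description precedes it below -/
import Mathlib

section
/- Suppose f_1,…,f_n is a homogeneous system of parameters of F[V]^G with deg f_i = d_i. Then the top degree of the coinvariant ring F[V]_G is at most (d_1 − 1) + (d_2 − 1) + … + (d_n − 1); that is, every homogeneous polynomial in F[V] of degree greater than Σ_{i=1}^n (d_i − 1) lies in the Hilbert ideal I_H. -/
open MvPolynomial

noncomputable section

/-- The Hilbert ideal of an action of a group `G` on `F[x₁,…,xₙ]` by `F`-algebra
automorphisms: the ideal generated by the `G`-invariant polynomials of positive degree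
(equivalently, those with zero constant term). -/
def hilbertIdealOf {F : Type*} [Field F] {n : ℕ} {G : Type*} [Group G]
    (φ : G →* (MvPolynomial (Fin n) F ≃ₐ[F] MvPolynomial (Fin n) F)) :
    Ideal (MvPolynomial (Fin n) F) :=
  Ideal.span {f | (∀ g : G, φ g f = f) ∧ constantCoeff f = 0}

/-- Koszul matrices. -/
theorem koszul_matrix {F : Type*} [Field F] {n : ℕ} (m : ℕ)
    (f : Fin m → MvPolynomial (Fin n) F) (d : Fin m → ℕ)
    (hhom : ∀ i, (f i).IsHomogeneous (d i)) :
    ∃ (ι : Type) (_ : Fintype ι) (_ : DecidableEq ι) (w h : ι → ℕ) (i0 : ι)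
      (D : Matrix ι ι (MvPolynomial (Fin n) F)),
      D * D = 0 ∧
      (∀ a b, D a b ≠ 0 → h b = h a + 1 ∧ ∃ k, w b = w a + k ∧ (D a b).IsHomogeneous k) ∧
      (h i0 = 0 ∧ w i0 = 0) ∧ (∀ b, D i0 b ∈ Ideal.span (Set.range f)) ∧
      (∀ a, h a ≤ m) ∧ (∀ a, h a = m → w a = ∑ i, d i) ∧
      (∀ (β : Fin m → MvPolynomial (Fin n) F) (N : ℕ),
        (∀ i, β i ≠ 0 → ∃ k, k + d i = N ∧ (β i).IsHomogeneous k) →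
        ∃ S : Matrix ι ι (MvPolynomial (Fin n) F),
          D * S + S * D = (∑ i, β i * f i) • (1 : Matrix ι ι (MvPolynomial (Fin n) F)) ∧
          (∀ a b, S a b ≠ 0 →
            h a = h b + 1 ∧ ∃ k, k + w a = N + w b ∧ (S a b).IsHomogeneous k)) := by
  induction m with
  | zero =>
    refine ⟨Unit, inferInstance, inferInstance, fun _ => 0, fun _ => 0, (), 0, by simp, by simp,
      by simp, by simp, by simp, by simp, ?_⟩
    intro β N _
    exact ⟨0, by simp, by simp⟩
  | succ m ih =>
    obtain ⟨ι, _, _, w, h, i0, D, hDD, hD, hi0, hsp, hle, htop, hS⟩ :=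
      ih (fun i => f i.succ) (fun i => d i.succ) (fun i => hhom i.succ)
    refine ⟨ι ⊕ ι, inferInstance, inferInstance, Sum.elim w (fun a => w a + d 0),
      Sum.elim h (fun a => h a + 1), Sum.inl i0,
      Matrix.fromBlocks D (f 0 • 1) 0 (-D), ?_, ?_, ?_, ?_, ?_, ?_, ?_⟩
    · rw [Matrix.fromBlocks_multiply]
      simp [hDD]
    · rintro (a | a) (b | b) hab
      · exact hD a b hab
      · simp only [Matrix.fromBlocks_apply₁₂, Matrix.smul_apply, Matrix.one_apply] at hab ⊢
        by_cases e : a = b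
        · subst e
          refine ⟨rfl, d 0, rfl, ?_⟩
          simpa using hhom 0
        · simp [e] at hab
      · simp at hab
      · simp only [Matrix.fromBlocks_apply₂₂, Matrix.neg_apply, ne_eq, neg_eq_zero] at hab ⊢
        obtain ⟨h1, k, hk, hk2⟩ := hD a b hab
        refine ⟨by simp [h1], k, by simp [hk]; ring, ?_⟩
        exact (homogeneousSubmodule (Fin n) F k).neg_mem hk2
    · simpa using hi0
    · rintro (b | b)
      · refine Ideal.span_mono ?_ (hsp b)
        rintro _ ⟨i, rfl⟩
        exact ⟨i.succ, rfl⟩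
      · simp only [Matrix.fromBlocks_apply₁₂, Matrix.smul_apply, smul_eq_mul]
        exact Ideal.mul_mem_right _ _ (Ideal.subset_span ⟨0, rfl⟩)
    · rintro (a | a)
      · exact (hle a).trans (Nat.le_succ _)
      · exact Nat.succ_le_succ (hle a)
    · rintro (a | a) ha
      · have := hle a
        simp only [Sum.elim_inl] at ha
        omega
      · simp only [Sum.elim_inr, Nat.add_right_cancel_iff] at ha ⊢
        rw [htop a ha, Fin.sum_univ_succ, add_comm]
    · intro β N hβ
      obtain ⟨S, hS1, hS2⟩ := hS (fun i => β i.succ) N (fun i => hβ i.succ)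
      refine ⟨Matrix.fromBlocks S 0 (β 0 • 1) (-S), ?_, ?_⟩
      · rw [Matrix.fromBlocks_multiply, Matrix.fromBlocks_multiply, Matrix.fromBlocks_add,
          ← Matrix.fromBlocks_one, Matrix.fromBlocks_smul, Fin.sum_univ_succ, add_smul, ← hS1]
        congr 1
        · simp [smul_smul]; abel
        · simp
        · simp
        · simp [smul_smul]; rw [mul_comm (f 0)]; abel
      · rintro (a | a) (b | b) hab
        · exact hS2 a b hab
        · simp at hab
        · simp only [Matrix.fromBlocks_apply₂₁, Matrix.smul_apply, Matrix.one_apply] at hab ⊢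
          by_cases e : a = b
          · subst e
            simp only [if_true, smul_eq_mul, mul_one] at hab ⊢
            obtain ⟨k, hk, hk2⟩ := hβ 0 hab
            exact ⟨rfl, k, by simp; omega, hk2⟩
          · simp [e] at hab
        · simp only [Matrix.fromBlocks_apply₂₂, Matrix.neg_apply, ne_eq, neg_eq_zero] at hab ⊢
          obtain ⟨h1, k, hk, hk2⟩ := hS2 a b hab
          refine ⟨by simp [h1], k, by simp; omega, ?_⟩
          exact (homogeneousSubmodule (Fin n) F k).neg_mem hk2

theorem homComp_mul {F : Type*} [Field F] {n : ℕ} (b f : MvPolynomial (Fin n) F) (d c : ℕ)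
    (hf : f.IsHomogeneous d) :
    homogeneousComponent c (b * f) =
      (if d ≤ c then homogeneousComponent (c - d) b else 0) * f := by
  classical
  conv_lhs => rw [← sum_homogeneousComponent b, Finset.sum_mul, map_sum]
  have key : ∀ i, homogeneousComponent c (homogeneousComponent i b * f) =
      if i + d = c then homogeneousComponent i b * f else 0 := by
    intro i
    have := homogeneousComponent_of_mem (m := c) (n := i + d)
      ((mem_homogeneousSubmodule _ _).2 ((homogeneousComponent_isHomogeneous i b).mul hf))
    rw [this]
    simp [eq_comm]
  simp_rw [key]
  split_ifs with hd
  · rw [Finset.sum_eq_single (c - d)]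
    · simp [hd]
    · intro i _ hi
      rw [if_neg (by omega)]
    · intro hi
      rw [homogeneousComponent_eq_zero]
      · simp
      · simp at hi; omega
  · rw [zero_mul]
    exact Finset.sum_eq_zero fun i _ => if_neg (by omega)

theorem hsop_pow {F : Type*} [Field F] {n : ℕ}
    (f : Fin n → MvPolynomial (Fin n) F) (d : Fin n → ℕ)
    (hhom : ∀ i, (f i).IsHomogeneous (d i)) (hdpos : ∀ i, 0 < d i)
    (hfin : Module.Finite (Algebra.adjoin F (Set.range f)) (MvPolynomial (Fin n) F))
    (k : Fin n) :
    ∃ (N : ℕ) (β : Fin n → MvPolynomial (Fin n) F),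
      (∀ i, β i ≠ 0 → ∃ k, k + d i = N ∧ (β i).IsHomogeneous k) ∧
      (∑ i, β i * f i) = X k ^ N := by
  classical
  set I := Ideal.span (Set.range f) with hI
  have hcc : ∀ i, constantCoeff (f i) = 0 := by
    intro i
    rw [constantCoeff_eq]
    exact (hhom i).coeff_eq_zero (by simpa using (hdpos i).ne)
  have hA : ∀ a ∈ Algebra.adjoin F (Set.range f), a - C (constantCoeff a) ∈ I := by
    intro a ha
    induction ha using Algebra.adjoin_induction with
    | mem x hx =>
      obtain ⟨i, rfl⟩ := hx
      rw [hcc, map_zero, sub_zero]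
      exact Ideal.subset_span ⟨i, rfl⟩
    | algebraMap r => simp [MvPolynomial.algebraMap_eq]
    | add x y _ _ hx hy =>
      have := I.add_mem hx hy
      convert this using 1
      simp only [map_add]; ring
    | mul x y _ _ hx hy =>
      have := I.add_mem (I.mul_mem_right y hx) (I.mul_mem_left (C (constantCoeff x)) hy)
      convert this using 1
      simp only [map_mul]; ring
  obtain ⟨p, hpm, hp⟩ := (Algebra.IsIntegral.of_finite (Algebra.adjoin F (Set.range f))
    (MvPolynomial (Fin n) F)).isIntegral (X k)
  rw [Polynomial.eval₂_eq_sum_range] at hp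
  have hq : (∑ i ∈ Finset.range (p.natDegree + 1),
      C (constantCoeff (p.coeff i : MvPolynomial (Fin n) F)) * X k ^ i) ∈ I := by
    have : (∑ i ∈ Finset.range (p.natDegree + 1),
      ((p.coeff i : MvPolynomial (Fin n) F) -
        C (constantCoeff (p.coeff i : MvPolynomial (Fin n) F))) * X k ^ i) ∈ I :=
      I.sum_mem fun i _ => I.mul_mem_right _ (hA _ (p.coeff i).2)
    simp_rw [sub_mul] at this
    rw [Finset.sum_sub_distrib] at this
    change _ - _ ∈ _ at this
    have hp' : ∑ i ∈ Finset.range (p.natDegree + 1),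
      (p.coeff i : MvPolynomial (Fin n) F) * X k ^ i = 0 := hp
    rw [hp', zero_sub] at this
    exact neg_mem_iff.1 this
  obtain ⟨c, hc⟩ := (Ideal.mem_span_range_iff_exists_fun).1 hq
  refine ⟨p.natDegree, fun i => if d i ≤ p.natDegree then
    homogeneousComponent (p.natDegree - d i) (c i) else 0, ?_, ?_⟩
  · intro i hi
    by_cases h : d i ≤ p.natDegree
    · simp only [h, if_true]
      exact ⟨p.natDegree - d i, by omega, homogeneousComponent_isHomogeneous _ _⟩
    · simp [h] at hi
  · have := congrArg (homogeneousComponent p.natDegree) hc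
    rw [map_sum, map_sum] at this
    simp_rw [homComp_mul _ _ _ _ (hhom _)] at this
    rw [this]
    simp_rw [homogeneousComponent_C_mul]
    rw [Finset.sum_eq_single p.natDegree]
    · have h1 : p.coeff p.natDegree = 1 := hpm
      rw [h1, homogeneousComponent_eq_self (isHomogeneous_X_pow k _)]
      simp
    · intro i _ hi
      rw [homogeneousComponent_of_mem (n := i)
        ((mem_homogeneousSubmodule _ _).2 (isHomogeneous_X_pow k i))]
      simp [hi.symm]
    · simp

/-- Laurent polynomials with support in `T`. -/
def suppIn {F : Type*} [Field F] {n : ℕ} (T : Set (Fin n → ℤ)) :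
    AddSubgroup (AddMonoidAlgebra F (Fin n → ℤ)) where
  carrier := {p | ∀ v, p.coeff v ≠ 0 → v ∈ T}
  zero_mem' := by
    intro v hv
    exact absurd (by simp) hv
  add_mem' := by
    intro p q hp hq v hv
    by_contra h
    apply hv
    have h1 : p.coeff v = 0 := by_contra fun h' => h (hp v h')
    have h2 : q.coeff v = 0 := by_contra fun h' => h (hq v h')
    simp [h1, h2]
  neg_mem' := by
    intro p hp v hv
    apply hp v
    simpa using hv

theorem mem_suppIn {F : Type*} [Field F] {n : ℕ} {T : Set (Fin n → ℤ)}
    {p : AddMonoidAlgebra F (Fin n → ℤ)} :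
    p ∈ suppIn T ↔ ∀ v, p.coeff v ≠ 0 → v ∈ T := Iff.rfl

theorem suppIn_mono {F : Type*} [Field F] {n : ℕ} {T U : Set (Fin n → ℤ)}
    {p : AddMonoidAlgebra F (Fin n → ℤ)} (hp : p ∈ suppIn T) (h : ∀ v ∈ T, v ∈ U) :
    p ∈ suppIn U := fun v hv => h v (hp v hv)

theorem suppIn_mul {F : Type*} [Field F] {n : ℕ} {T U V : Set (Fin n → ℤ)}
    {p q : AddMonoidAlgebra F (Fin n → ℤ)} (hp : p ∈ suppIn T) (hq : q ∈ suppIn U)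
    (h : ∀ v ∈ T, ∀ u ∈ U, v + u ∈ V) : p * q ∈ suppIn V := by
  classical
  intro v hv
  have h1 := AddMonoidAlgebra.support_coeff_mul_subset p q (Finsupp.mem_support_iff.2 hv)
  obtain ⟨a, ha, b, hb, rfl⟩ := Finset.mem_add.1 h1
  exact h a (hp a (Finsupp.mem_support_iff.1 ha)) b (hq b (Finsupp.mem_support_iff.1 hb))

theorem suppIn_single {F : Type*} [Field F] {n : ℕ} (u : Fin n → ℤ) (r : F) :
    (AddMonoidAlgebra.single u r : AddMonoidAlgebra F (Fin n → ℤ)) ∈ suppIn {u} := by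
  classical
  intro v hv
  rw [AddMonoidAlgebra.coeff_single, Finsupp.single_apply] at hv
  by_contra h
  apply hv
  rw [if_neg]
  exact fun h' => h h'.symm

/-- Splitting off the part of a Laurent polynomial with support in `U`. -/
theorem suppIn_split {F : Type*} [Field F] {n : ℕ} {T : Set (Fin n → ℤ)} (U : Set (Fin n → ℤ))
    {p : AddMonoidAlgebra F (Fin n → ℤ)} (hp : p ∈ suppIn T) :
    ∃ r : AddMonoidAlgebra F (Fin n → ℤ), r ∈ suppIn (T ∩ U) ∧ p - r ∈ suppIn (T \ U) := by
  classical
  refine ⟨.ofCoeff (p.coeff.filter (· ∈ U)), ?_, ?_⟩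
  · intro v hv
    by_cases h : v ∈ U
    · refine ⟨hp v ?_, h⟩
      simpa [Finsupp.filter_apply, h] using hv
    · simp [h] at hv
  · intro v hv
    by_cases h : v ∈ U
    · simp [h] at hv
    · refine ⟨hp v ?_, h⟩
      simpa [Finsupp.filter_apply, h] using hv

/-- Exponents of polynomials as exponents of Laurent polynomials. -/
def expHom (n : ℕ) : (Fin n →₀ ℕ) →+ (Fin n → ℤ) where
  toFun m := fun i => (m i : ℤ)
  map_zero' := by ext; simp
  map_add' := by intros; ext; simp

theorem expHom_injective (n : ℕ) : Function.Injective (expHom n) := by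
  intro a b h
  ext i
  have := congrFun h i
  simpa [expHom] using this

/-- The inclusion of polynomials in Laurent polynomials. -/
def toLaurent (F : Type*) [Field F] (n : ℕ) :
    MvPolynomial (Fin n) F →+* AddMonoidAlgebra F (Fin n → ℤ) :=
  AddMonoidAlgebra.mapDomainRingHom F (expHom n)

theorem toLaurent_injective (F : Type*) [Field F] (n : ℕ) :
    Function.Injective (toLaurent F n) :=
  AddMonoidAlgebra.mapDomain_injective (expHom_injective n)

theorem toLaurent_monomial {F : Type*} [Field F] {n : ℕ} (m : Fin n →₀ ℕ) (r : F) :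
    toLaurent F n (monomial m r) = AddMonoidAlgebra.single (expHom n m) r :=
  AddMonoidAlgebra.mapDomain_single

theorem toLaurent_suppIn {F : Type*} [Field F] {n : ℕ} (p : MvPolynomial (Fin n) F) :
    toLaurent F n p ∈ suppIn {v | ∀ i, 0 ≤ v i} := by
  rw [p.as_sum, map_sum]
  refine AddSubgroup.sum_mem _ fun m _ => ?_
  rw [toLaurent_monomial]
  refine suppIn_mono (suppIn_single _ _) ?_
  rintro _ rfl i
  simp [expHom]

theorem toLaurent_hom {F : Type*} [Field F] {n : ℕ} (p : MvPolynomial (Fin n) F) (k : ℕ)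
    (hp : p.IsHomogeneous k) :
    toLaurent F n p ∈ suppIn {v | (∀ i, 0 ≤ v i) ∧ ∑ i, v i = k} := by
  rw [p.as_sum, map_sum]
  refine AddSubgroup.sum_mem _ fun m hm => ?_
  rw [toLaurent_monomial]
  refine suppIn_mono (suppIn_single _ _) ?_
  have h1 : m.degree = k := by
    by_contra h
    exact (mem_support_iff.1 hm) (hp.coeff_eq_zero h)
  rintro _ rfl
  refine ⟨fun i => by simp [expHom], ?_⟩
  rw [← h1, Finsupp.degree_eq_sum]
  simp [expHom]

theorem toLaurent_surj {F : Type*} [Field F] {n : ℕ} (q : AddMonoidAlgebra F (Fin n → ℤ))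
    (hq : q ∈ suppIn {v | ∀ i, 0 ≤ v i}) : ∃ p, toLaurent F n p = q := by
  classical
  refine ⟨∑ v ∈ q.coeff.support,
    monomial (Finsupp.equivFunOnFinite.symm fun i => (v i).toNat) (q.coeff v), ?_⟩
  rw [map_sum]
  simp_rw [toLaurent_monomial]
  have : ∀ v ∈ q.coeff.support,
      (AddMonoidAlgebra.single (expHom n (Finsupp.equivFunOnFinite.symm fun i => (v i).toNat))
        (q.coeff v) : AddMonoidAlgebra F (Fin n → ℤ)) = AddMonoidAlgebra.single v (q.coeff v) := by
    intro v hv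
    congr 1
    ext i
    simpa [expHom] using hq v (Finsupp.mem_support_iff.1 hv) i
  rw [Finset.sum_congr rfl this]
  ext v
  simp +contextual [Finsupp.single_apply, eq_comm]

/-- Exponents that are nonnegative from the index `k` on, of total degree `c`. -/
def setA (n k : ℕ) (c : ℤ) : Set (Fin n → ℤ) :=
  {v | (∀ i : Fin n, k ≤ i.val → 0 ≤ v i) ∧ ∑ i, v i = c}

/-- Exponents having a nonnegative entry at some index below `k`. -/
def setB (n k : ℕ) : Set (Fin n → ℤ) := {v | ∃ i : Fin n, i.val < k ∧ 0 ≤ v i}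

theorem mulVec_setB {F : Type*} [Field F] {n : ℕ} {ι : Type} [Fintype ι]
    (M : Matrix ι ι (MvPolynomial (Fin n) F)) (k : ℕ) (z : ι → AddMonoidAlgebra F (Fin n → ℤ))
    (hz : ∀ a, z a ∈ suppIn (setB n k)) (a : ι) :
    (M.map (toLaurent F n)).mulVec z a ∈ suppIn (setB n k) := by
  refine AddSubgroup.sum_mem _ fun b _ => ?_
  refine suppIn_mul (toLaurent_suppIn (M a b)) (hz b) ?_
  rintro v hv u ⟨i, hi, hu⟩
  exact ⟨i, hi, add_nonneg (hv i) hu⟩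

theorem mulVec_setA {F : Type*} [Field F] {n : ℕ} {ι : Type} [Fintype ι]
    (M : Matrix ι ι (MvPolynomial (Fin n) F)) (k : ℕ) (z : ι → AddMonoidAlgebra F (Fin n → ℤ))
    (c c' : ι → ℤ)
    (hM : ∀ a b, M a b ≠ 0 → ∃ j : ℕ, c' a = c b + j ∧ (M a b).IsHomogeneous j)
    (hz : ∀ a, z a ∈ suppIn (setA n k (c a))) (a : ι) :
    (M.map (toLaurent F n)).mulVec z a ∈ suppIn (setA n k (c' a)) := by
  refine AddSubgroup.sum_mem _ fun b _ => ?_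
  by_cases h0 : M a b = 0
  · simp only [Matrix.map_apply, h0, map_zero, zero_mul]
    exact AddSubgroup.zero_mem _
  obtain ⟨j, hj, hh⟩ := hM a b h0
  refine suppIn_mul (toLaurent_hom (M a b) j hh) (hz b) ?_
  rintro v ⟨hv, hvs⟩ u ⟨hu, hus⟩
  refine ⟨fun i hi => add_nonneg (hv i) (hu i hi), ?_⟩
  simp only [Pi.add_apply, Finset.sum_add_distrib, hvs, hus, hj]
  ring

theorem mulVec_conc {F : Type*} [Field F] {n : ℕ} {ι : Type} [Fintype ι]
    (M : Matrix ι ι (MvPolynomial (Fin n) F)) (z : ι → AddMonoidAlgebra F (Fin n → ℤ))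
    (P Q : ι → Prop) (hM : ∀ a b, M a b ≠ 0 → P b → Q a)
    (hz : ∀ a, ¬ P a → z a = 0) (a : ι) (ha : ¬ Q a) :
    (M.map (toLaurent F n)).mulVec z a = 0 := by
  refine Finset.sum_eq_zero fun b _ => ?_
  by_cases h0 : M a b = 0
  · simp [h0]
  · simp only [hz b fun hP => ha (hM a b h0 hP), mul_zero]

/-- The vanishing of the `k`-th Koszul homology in degree `e` of the `k`-th local cohomology
module along the first `k` variables. -/
def KVanish {F : Type*} [Field F] {n : ℕ} {ι : Type} [Fintype ι] (w h : ι → ℕ)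
    (D : Matrix ι ι (MvPolynomial (Fin n) F)) (e : ℤ) (k : ℕ) : Prop :=
  ∀ z : ι → AddMonoidAlgebra F (Fin n → ℤ),
    (∀ a, ¬ h a = k → z a = 0) → (∀ a, z a ∈ suppIn (setA n k (e - w a))) →
    (∀ a, (D.map (toLaurent F n)).mulVec z a ∈ suppIn (setB n k)) →
    ∃ u : ι → AddMonoidAlgebra F (Fin n → ℤ),
      (∀ a, ¬ h a = k + 1 → u a = 0) ∧ (∀ a, u a ∈ suppIn (setA n k (e - w a))) ∧
      ∀ a, (D.map (toLaurent F n)).mulVec u a - z a ∈ suppIn (setB n k)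

theorem kVanish_step {F : Type*} [Field F] {n : ℕ} {ι : Type} [Fintype ι] [DecidableEq ι]
    (w h : ι → ℕ) (D : Matrix ι ι (MvPolynomial (Fin n) F)) (e : ℤ) (k : Fin n)
    (hDD : D * D = 0)
    (hD : ∀ a b, D a b ≠ 0 → h b = h a + 1 ∧ ∃ k, w b = w a + k ∧ (D a b).IsHomogeneous k)
    (N : ℕ) (S : Matrix ι ι (MvPolynomial (Fin n) F))
    (hS : D * S + S * D = (X k ^ N : MvPolynomial (Fin n) F) •
      (1 : Matrix ι ι (MvPolynomial (Fin n) F)))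
    (hS2 : ∀ a b, S a b ≠ 0 →
            h a = h b + 1 ∧ ∃ k, k + w a = N + w b ∧ (S a b).IsHomogeneous k)
    (hV : KVanish w h D e (k.val + 1)) : KVanish w h D e k.val := by
  classical
  intro z hz1 hz2 hz3
  set ρ := toLaurent F n with hρ
  set t : AddMonoidAlgebra F (Fin n → ℤ) :=
    AddMonoidAlgebra.single (Pi.single k (-(N : ℤ))) 1 with ht
  have htx : t * ρ (X k ^ N) = 1 := by
    rw [X_pow_eq_monomial, hρ, toLaurent_monomial, ht, AddMonoidAlgebra.single_mul_single,
      AddMonoidAlgebra.one_def]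
    congr 1
    · ext i
      by_cases hi : i = k
      · subst hi; simp [expHom]
      · simp [expHom, hi, Finsupp.single_apply, Ne.symm hi]
    · simp
  have hDD' : ∀ x, (D.map ρ).mulVec ((D.map ρ).mulVec x) = 0 := by
    intro x
    rw [Matrix.mulVec_mulVec, ← Matrix.map_mul, hDD]
    simp
  have hDS' : ∀ x, (D.map ρ).mulVec ((S.map ρ).mulVec x) + (S.map ρ).mulVec ((D.map ρ).mulVec x)
      = ρ (X k ^ N) • x := by
    intro x
    rw [Matrix.mulVec_mulVec, Matrix.mulVec_mulVec, ← Matrix.map_mul, ← Matrix.map_mul,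
      ← Matrix.add_mulVec, ← Matrix.map_add _ (map_add ρ), hS]
    ext1 a
    simp [Matrix.mulVec, dotProduct, Matrix.one_apply, apply_ite ρ]
  -- the first lift
  set y : ι → AddMonoidAlgebra F (Fin n → ℤ) := t • (S.map ρ).mulVec z with hy
  have hDy : (D.map ρ).mulVec y = z - t • (S.map ρ).mulVec ((D.map ρ).mulVec z) := by
    rw [hy, Matrix.mulVec_smul, eq_sub_iff_add_eq, ← smul_add, hDS', smul_smul, htx, one_smul]
  have hres : ∀ a, (t • (S.map ρ).mulVec ((D.map ρ).mulVec z)) a ∈ suppIn (setB n k.val) := by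
    intro a
    refine suppIn_mul (suppIn_single _ _) (mulVec_setB S k.val _ hz3 a) ?_
    rintro _ rfl u ⟨i, hi, hu⟩
    refine ⟨i, hi, ?_⟩
    have : i ≠ k := fun hh => by subst hh; omega
    simpa [this] using hu
  have hBB : ∀ v ∈ setB n k.val, v ∈ setB n (k.val + 1) := by
    rintro v ⟨i, hi, hv⟩
    exact ⟨i, by omega, hv⟩
  have hy1 : ∀ a, ¬ h a = k.val + 1 → y a = 0 := by
    intro a ha
    have := mulVec_conc S z (fun a => h a = k.val) (fun a => h a = k.val + 1)
      (fun a b hab hb => by have := (hS2 a b hab).1; omega) hz1 a ha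
    simp only [hy, Pi.smul_apply, smul_eq_mul]
    rw [hρ, this, mul_zero]
  have hy2 : ∀ a, y a ∈ suppIn (setA n (k.val + 1) (e - w a)) := by
    intro a
    refine suppIn_mul (suppIn_single _ _) (mulVec_setA S k.val z (fun a => e - w a)
      (fun a => e - w a + N) ?_ hz2 a) ?_
    · intro a b hab
      obtain ⟨-, j, hj, hh⟩ := hS2 a b hab
      exact ⟨j, by omega, hh⟩
    · rintro _ rfl u ⟨hu, hus⟩
      refine ⟨fun i hi => ?_, ?_⟩
      · have : i ≠ k := fun hh => by subst hh; omega
        simpa [this] using hu i (by omega)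
      · simp [Finset.sum_add_distrib, hus]
  have hy3 : ∀ a, (D.map ρ).mulVec y a ∈ suppIn (setB n (k.val + 1)) := by
    intro a
    rw [hDy]
    refine AddSubgroup.sub_mem _ (suppIn_mono (hz2 a) ?_) (suppIn_mono (hres a) hBB)
    rintro v ⟨hv, -⟩
    exact ⟨k, by omega, hv k le_rfl⟩
  obtain ⟨u, hu1, hu2, hu3⟩ := hV y hy1 hy2 hy3
  -- the corrected lift
  set y' : ι → AddMonoidAlgebra F (Fin n → ℤ) := y - (D.map ρ).mulVec u with hy'
  have hy'1 : ∀ a, ¬ h a = k.val + 1 → y' a = 0 := by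
    intro a ha
    have := mulVec_conc D u (fun a => h a = k.val + 1 + 1) (fun a => h a = k.val + 1)
      (fun a b hab hb => by have := (hD a b hab).1; omega) hu1 a ha
    simp only [hy', Pi.sub_apply, hy1 a ha]
    rw [hρ, this, sub_zero]
  have hy'2 : ∀ a, y' a ∈ suppIn (setA n (k.val + 1) (e - w a)) := by
    intro a
    refine AddSubgroup.sub_mem _ (hy2 a) (mulVec_setA D _ u (fun a => e - w a)
      (fun a => e - w a) ?_ hu2 a)
    intro a b hab
    obtain ⟨-, j, hj, hh⟩ := hD a b hab
    exact ⟨j, by omega, hh⟩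
  have hy'3 : ∀ a, y' a ∈ suppIn (setB n (k.val + 1)) := by
    intro a
    have := AddSubgroup.neg_mem _ (hu3 a)
    rwa [neg_sub] at this
  have hy'D : (D.map ρ).mulVec y' = z - t • (S.map ρ).mulVec ((D.map ρ).mulVec z) := by
    rw [hy', Matrix.mulVec_sub, hDD', sub_zero, hDy]
  choose r hr1 hr2 using fun a => suppIn_split {v : Fin n → ℤ | 0 ≤ v k}
    (T := setA n (k.val + 1) (e - w a) ∩ setB n (k.val + 1)) (p := y' a)
    (fun v hv => ⟨hy'2 a v hv, hy'3 a v hv⟩)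
  have hr0 : ∀ a, y' a = 0 → r a = 0 := by
    intro a ha
    ext v
    by_contra hv
    have h1 := (hr1 a v hv).2
    refine (hr2 a v ?_).2 h1
    rw [ha]
    simpa using hv
  refine ⟨r, fun a ha => hr0 a (hy'1 a ha), ?_, ?_⟩
  · intro a
    refine suppIn_mono (hr1 a) ?_
    rintro v ⟨⟨⟨hv, hvs⟩, -⟩, hvk⟩
    refine ⟨fun i hi => ?_, hvs⟩
    by_cases hik : i = k
    · subst hik; exact hvk
    · exact hv i (by have : i.val ≠ k.val := fun hh => hik (Fin.ext hh)
                     omega)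
  · intro a
    have hB : ∀ a, (y' - r) a ∈ suppIn (setB n k.val) := by
      intro a
      refine suppIn_mono (hr2 a) ?_
      rintro v ⟨⟨-, i, hi, hv⟩, hvk⟩
      refine ⟨i, ?_, hv⟩
      have : i.val ≠ k.val := fun hh => hvk (by
        have := Fin.ext hh
        subst this
        exact hv)
      omega
    have h1 := mulVec_setB D k.val (y' - r) hB a
    have h2 := AddSubgroup.neg_mem _ (AddSubgroup.add_mem _ h1 (hres a))
    convert h2 using 1
    rw [Matrix.mulVec_sub, ← hρ, hy'D]
    simp only [Pi.sub_apply]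
    ring

theorem macaulay_bound {F : Type*} [Field F] {n : ℕ}
    (f : Fin n → MvPolynomial (Fin n) F) (d : Fin n → ℕ)
    (hhom : ∀ i, (f i).IsHomogeneous (d i)) (hdpos : ∀ i, 0 < d i)
    (hfin : Module.Finite (Algebra.adjoin F (Set.range f)) (MvPolynomial (Fin n) F))
    (p : MvPolynomial (Fin n) F) (e : ℕ) (hp : p.IsHomogeneous e)
    (he : (∑ i, (d i - 1)) < e) : p ∈ Ideal.span (Set.range f) := by
  classical
  obtain ⟨ι, _, _, w, h, i0, D, hDD, hD, hi0, hsp, hle, htop, hS⟩ := koszul_matrix n f d hhom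
  have hsum : (∑ i, (d i : ℤ)) < e + n := by
    have h1 : (∑ i, d i) = (∑ i, (d i - 1)) + n := by
      have : ∑ i, d i = ∑ i, ((d i - 1) + 1) :=
        Finset.sum_congr rfl fun i _ => by have := hdpos i; omega
      rw [this, Finset.sum_add_distrib]
      simp
    have h2 : ∑ i, d i < e + n := by omega
    exact_mod_cast h2
  have hn : KVanish w h D (e : ℤ) n := by
    intro z hz1 hz2 _
    refine ⟨0, by simp, fun a => AddSubgroup.zero_mem _, fun a => ?_⟩
    rw [Matrix.mulVec_zero, Pi.zero_apply, zero_sub]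
    refine AddSubgroup.neg_mem _ ?_
    by_cases ha : h a = n
    · refine suppIn_mono (hz2 a) ?_
      rintro v ⟨-, hv⟩
      by_contra hcon
      have h1 : ∀ i : Fin n, v i ≤ -1 := by
        intro i
        by_contra h'
        exact hcon ⟨i, i.2, by omega⟩
      have h2 : ∑ i, v i ≤ ∑ i : Fin n, (-1 : ℤ) := Finset.sum_le_sum fun i _ => h1 i
      rw [hv, htop a ha] at h2
      simp at h2
      omega
    · rw [hz1 a ha]
      exact AddSubgroup.zero_mem _
  have hall : ∀ j, j ≤ n → KVanish w h D (e : ℤ) (n - j) := by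
    intro j
    induction j with
    | zero => intro _; exact hn
    | succ j ih =>
      intro hj
      obtain ⟨N, β, hβ, hβf⟩ := hsop_pow f d hhom hdpos hfin ⟨n - (j + 1), by omega⟩
      obtain ⟨S, hS1, hS2⟩ := hS β N hβ
      rw [hβf] at hS1
      refine kVanish_step w h D e ⟨n - (j + 1), by omega⟩ hDD hD N S hS1 hS2 ?_
      have := ih (by omega)
      convert this using 1
      simp only
      omega
  have h0 := hall n le_rfl
  rw [Nat.sub_self] at h0
  have h0' := h0 (Pi.single i0 (toLaurent F n p)) ?_ ?_ ?_
  · obtain ⟨u, -, hu2, hu3⟩ := h0'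
    have hu : ∀ a, ∃ q, toLaurent F n q = u a := fun a =>
      toLaurent_surj _ (suppIn_mono (hu2 a) fun v hv i => hv.1 i (Nat.zero_le _))
    choose q hq using hu
    have h1 : (D.map (toLaurent F n)).mulVec u i0 - toLaurent F n p = 0 := by
      ext v
      by_contra hv
      have := hu3 i0 v (by simpa using hv)
      obtain ⟨i, hi, -⟩ := this
      omega
    have h2 : toLaurent F n p = toLaurent F n (∑ b, D i0 b * q b) := by
      rw [← sub_eq_zero.1 h1, map_sum]
      simp [Matrix.mulVec, dotProduct, hq]
    rw [toLaurent_injective F n h2]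
    exact Ideal.sum_mem _ fun b _ => Ideal.mul_mem_right _ _ (hsp b)
  · intro a ha
    have : a ≠ i0 := fun hh => ha (by rw [hh, hi0.1])
    simp [this]
  · intro a
    by_cases hh : a = i0
    · subst hh
      rw [Pi.single_eq_same, hi0.2]
      refine suppIn_mono (toLaurent_hom p e hp) ?_
      rintro v ⟨hv, hvs⟩
      exact ⟨fun i _ => hv i, by simpa using hvs⟩
    · simp only [Pi.single_apply, hh, if_false]
      exact AddSubgroup.zero_mem _
  · intro a
    rw [mulVec_conc D _ (fun a => h a = 0) (fun _ => False)
      (fun a b hab hb => by have := (hD a b hab).1; omega) _ a (fun hh => hh)]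
    · exact AddSubgroup.zero_mem _
    · intro a ha
      have : a ≠ i0 := fun hh => ha (by rw [hh, hi0.1])
      simp [this]

/-- If `f₁,…,fₙ` is a homogeneous system of parameters of `F[V]^G` with
`deg fᵢ = dᵢ`, then every homogeneous polynomial of degree greater than `∑ (dᵢ - 1)` lies in
the Hilbert ideal, i.e. the top degree of the coinvariants is at most `∑ (dᵢ - 1)`. -/
theorem topDegree_coinvariants_le_of_hsop
    {F : Type*} [Field F] {n : ℕ} {G : Type*} [Group G] [Finite G]
    (φ : G →* (MvPolynomial (Fin n) F ≃ₐ[F] MvPolynomial (Fin n) F))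
    (hlin : ∀ (g : G) (i : Fin n), ((φ g) (X i)).IsHomogeneous 1)
    (f : Fin n → MvPolynomial (Fin n) F) (d : Fin n → ℕ)
    (hhom : ∀ i, (f i).IsHomogeneous (d i)) (hdpos : ∀ i, 0 < d i)
    (hinv : ∀ (i : Fin n) (g : G), φ g (f i) = f i)
    (hfin : Module.Finite (Algebra.adjoin F (Set.range f)) (MvPolynomial (Fin n) F)) :
    ∀ (h : MvPolynomial (Fin n) F) (e : ℕ), h.IsHomogeneous e →
      (∑ i, (d i - 1)) < e → h ∈ hilbertIdealOf φ := by
  intro h e hh he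
  refine Ideal.span_le.2 ?_ (macaulay_bound f d hhom hdpos hfin h e hh he)
  rintro _ ⟨i, rfl⟩
  refine Ideal.subset_span ⟨hinv i, ?_⟩
  rw [constantCoeff_eq]
  exact (hhom i).coeff_eq_zero (by simpa using (hdpos i).ne)
end
end

section
/- Suppose f_1,…,f_n is a homogeneous system of parameters of F[V]^G with deg f_i = d_i. Then the coinvariant ring F[V]_G is a finite-dimensional F-vector space and dim_F F[V]_G ≤ d_1·d_2·…·d_n. -/
open MvPolynomial

noncomputable section

section helpers
open RingTheory.Sequence


lemma supportDim_le_ofList {R : Type*} [CommRing R] [IsLocalRing R] [IsNoetherianRing R]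
    (fs : List R) : ∀ (M : Type*) [AddCommGroup M] [Module R M] [Module.Finite R M],
    (∀ r ∈ fs, r ∈ IsLocalRing.maximalIdeal R) →
    Module.supportDim R M ≤
      Module.supportDim R (M ⧸ (Ideal.ofList fs • ⊤ : Submodule R M)) + fs.length := by
  induction fs with
  | nil =>
    intro M _ _ _ _
    have e : (M ⧸ (Ideal.ofList ([] : List R) • ⊤ : Submodule R M)) ≃ₗ[R] M :=
      Submodule.quotEquivOfEqBot _ (by simp)
    rw [Module.supportDim_eq_of_equiv e]
    simp
  | cons a fs ih =>
    intro M _ _ _ h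
    have h1 := Module.supportDim_le_supportDim_quotSMulTop_succ (M := M) (h a (by simp))
    have h2 := ih (QuotSMulTop a M) (fun r hr => h r (by simp [hr]))
    rw [Module.supportDim_eq_of_equiv
      (Submodule.quotOfListConsSMulTopEquivQuotSMulTopInner M a fs)]
    refine h1.trans ((add_le_add_left h2 1).trans ?_)
    simp [add_assoc]

lemma regular_of_pow_mem {R B : Type*} [CommRing R] [AddCommGroup B] [Module R B]
    (u a : R) (hu : IsSMulRegular B u)
    (h : u ∈ (Module.annihilator R B ⊔ Ideal.span {a}).radical) : IsSMulRegular B a := by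
  obtain ⟨N, hN⟩ := h
  obtain ⟨α, hα, β, hβ, e⟩ := Submodule.mem_sup.mp hN
  obtain ⟨c, rfl⟩ := Ideal.mem_span_singleton'.mp hβ
  rw [isSMulRegular_iff_right_eq_zero_of_smul]
  intro x hx
  have h1 : u ^ N • x = 0 := by
    rw [← e, add_smul, Module.mem_annihilator.mp hα, mul_smul, hx]; simp
  exact (isSMulRegular_iff_right_eq_zero_of_smul.mp (hu.pow N)) x h1

theorem isWeaklyRegular_of_sop {R : Type*} [CommRing R] [IsLocalRing R] [IsNoetherianRing R]
    (n : ℕ) : ∀ (M : Type*) [AddCommGroup M] [Module R M] [Module.Finite R M] (xs fs : List R),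
    xs.length = n → fs.length = n →
    (∀ r ∈ fs, r ∈ IsLocalRing.maximalIdeal R) → IsRegular M xs →
    Module.supportDim R M = n →
    Module.supportDim R (M ⧸ (Ideal.ofList fs • ⊤ : Submodule R M)) ≤ 0 →
    IsWeaklyRegular M fs := by
  induction n with
  | zero =>
    intro M _ _ _ xs fs _ hf _ _ _ _
    rw [List.length_eq_zero_iff] at hf
    subst hf
    exact IsWeaklyRegular.nil R M
  | succ n ih =>
    intro M _ _ _ xs fs hxl hfl hfm hx hdim hf0
    obtain ⟨b, xs, rfl⟩ := List.exists_of_length_succ _ hxl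
    obtain ⟨a, fs, rfl⟩ := List.exists_of_length_succ _ hfl
    have hxl' : xs.length = n := by simpa using hxl
    have hfl' : fs.length = n := by simpa using hfl
    have hnt : Nontrivial M := hx.nontrivial
    have hfm' : ∀ r ∈ fs, r ∈ IsLocalRing.maximalIdeal R := fun r hr => hfm r (by simp [hr])
    have ham := hfm a (by simp)
    have hxm : ∀ r ∈ b :: xs, r ∈ IsLocalRing.maximalIdeal R := by
      intro r hr
      refine IsLocalRing.le_maximalIdeal ?_ (Ideal.subset_span (s := {r | r ∈ b :: xs}) hr)
      intro htop
      apply hx.top_ne_smul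
      change ⊤ = Ideal.span {r | r ∈ b :: xs} • (⊤ : Submodule R M)
      rw [htop]; simp
    have hxw : IsWeaklyRegular M (xs ++ [b]) :=
      IsLocalRing.isWeaklyRegular_of_perm_of_subset_maximalIdeal hx.toIsWeaklyRegular
        (by simpa using (List.perm_append_comm (l₁ := [b]) (l₂ := xs))) hxm
    rw [isWeaklyRegular_append_iff, isWeaklyRegular_singleton_iff] at hxw
    obtain ⟨hxs, hb⟩ := hxw
    set A := M ⧸ (Ideal.ofList xs • ⊤ : Submodule R M) with hA
    set B := M ⧸ (Ideal.ofList fs • ⊤ : Submodule R M) with hB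
    have eB : QuotSMulTop a B ≃ₗ[R] (M ⧸ (Ideal.ofList (a :: fs) • ⊤ : Submodule R M)) :=
      (Submodule.quotOfListConsSMulTopEquivQuotSMulTopOuter M a fs).symm
    have hB1 : Module.supportDim R B ≤ 1 := by
      have := Module.supportDim_le_supportDim_quotSMulTop_succ (M := B) ham
      rw [Module.supportDim_eq_of_equiv eB] at this
      exact this.trans ((add_le_add_left hf0 1).trans (by simp))
    have hB2 : ¬ Module.supportDim R B ≤ 0 := by
      intro h
      have h1 := supportDim_le_ofList fs M hfm'
      rw [hdim, hfl'] at h1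
      have h2 : ((n + 1 : ℕ) : WithBot ℕ∞) ≤ 0 + n := h1.trans (add_le_add_left h _)
      rw [zero_add] at h2
      have : n + 1 ≤ n := by exact_mod_cast h2
      omega
    obtain ⟨u, hum, huA, huB⟩ : ∃ u ∈ IsLocalRing.maximalIdeal R,
        (∀ p ∈ associatedPrimes R A, u ∉ p) ∧
        (∀ p ∈ (Module.annihilator R B).minimalPrimes, u ∉ p) := by
      by_contra! hcon
      have hsub : ((IsLocalRing.maximalIdeal R : Ideal R) : Set R) ⊆
          ⋃ i ∈ associatedPrimes R A ∪ (Module.annihilator R B).minimalPrimes, ((id i : Ideal R) : Set R) := by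
        intro u hu
        by_cases h : ∀ p ∈ associatedPrimes R A, u ∉ p
        · obtain ⟨p, hp, hup⟩ := hcon u hu h
          exact Set.mem_biUnion (Or.inr hp) hup
        · push Not at h
          obtain ⟨p, hp, hup⟩ := h
          exact Set.mem_biUnion (Or.inl hp) hup
      rw [Ideal.subset_union_prime_finite ((associatedPrimes.finite R A).union
        (Ideal.finite_minimalPrimes_of_isNoetherianRing R _)) ⊥ ⊥] at hsub
      · obtain ⟨p, hp | hp, hle⟩ := hsub
        · have hbp : b ∈ ⋃ p ∈ associatedPrimes R A, (p : Set R) :=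
            Set.mem_biUnion hp (hle (hxm b (by simp)))
          rw [biUnion_associatedPrimes_eq_compl_regular] at hbp
          exact hbp hb
        · apply hB2
          rw [Module.supportDim, Module.support_eq_zeroLocus]
          apply Order.krullDim_nonpos_iff_forall_isMax.mpr
          rintro ⟨q, hq⟩ ⟨r, hr⟩ hqr
          have h1 : p ≤ q.asIdeal := by
            have : q.asIdeal ≤ p :=
              (IsLocalRing.le_maximalIdeal q.2.ne_top).trans hle
            exact hp.2 ⟨q.2, hq⟩ this
          change r.asIdeal ≤ q.asIdeal
          exact (IsLocalRing.le_maximalIdeal r.2.ne_top).trans (hle.trans h1)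
      · rintro i (hi | hi) _ _
        · exact hi.1
        · exact hi.1.1
    have huA' : IsSMulRegular A u := by
      by_contra h
      have : u ∈ ({ r : R | IsSMulRegular A r }ᶜ : Set R) := h
      rw [← biUnion_associatedPrimes_eq_compl_regular] at this
      obtain ⟨p, hp, hup⟩ := Set.mem_iUnion₂.mp this
      exact huA p hp hup
    have hux : IsWeaklyRegular M (u :: xs) := by
      refine IsLocalRing.isWeaklyRegular_of_perm_of_subset_maximalIdeal (rs := xs ++ [u]) ?_
        (by simpa using (List.perm_append_comm (l₁ := xs) (l₂ := [u]))) ?_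
      · rw [isWeaklyRegular_append_iff, isWeaklyRegular_singleton_iff]
        exact ⟨hxs, huA'⟩
      · intro r hr
        rw [List.mem_append, List.mem_singleton] at hr
        rcases hr with hr | rfl
        · exact hxm r (by simp [hr])
        · exact hum
    rw [isWeaklyRegular_cons_iff] at hux
    have hnt' : Nontrivial (QuotSMulTop u M) := nontrivial_quotSMulTop_of_mem_maximalIdeal M hum
    have hd : Module.supportDim R (QuotSMulTop u M) = n := by
      have := Module.supportDim_quotSMulTop_succ_eq_supportDim hux.1 hum
      rw [hdim] at this
      push_cast at this
      exact (ENat.WithBot.add_natCast_cancel (c := 1)).mp (by simpa using this)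
    have hBu : Module.supportDim R (QuotSMulTop u B) ≤ 0 := by
      have := (Module.supportDim_quotSMulTop_succ_le_of_notMem_minimalPrimes huB).trans hB1
      exact (ENat.WithBot.add_le_add_natCast_right_iff (c := 1)).mp (by simpa using this)
    have hfs := ih (QuotSMulTop u M) xs fs hxl' hfl' hfm'
      (.of_isWeaklyRegular_of_mem_maximalIdeal _ (fun r hr => hxm r (by simp [hr])) hux.2) hd (by
        rw [Module.supportDim_eq_of_equiv
          ((Submodule.quotOfListConsSMulTopEquivQuotSMulTopInner M u fs).symm.trans
          (Submodule.quotOfListConsSMulTopEquivQuotSMulTopOuter M u fs))]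
        exact hBu)
    have huf : IsWeaklyRegular M (u :: fs) := by
      rw [isWeaklyRegular_cons_iff]; exact ⟨hux.1, hfs⟩
    have huf' : IsWeaklyRegular M (fs ++ [u]) :=
      IsLocalRing.isWeaklyRegular_of_perm_of_subset_maximalIdeal huf
        (by simpa using (List.perm_append_comm (l₁ := [u]) (l₂ := fs))) (by
          intro r hr
          rcases List.mem_cons.mp hr with rfl | hr
          · exact hum
          · exact hfm' r hr)
    rw [isWeaklyRegular_append_iff, isWeaklyRegular_singleton_iff] at huf'
    have haB : IsSMulRegular B a := by
      refine regular_of_pow_mem u a huf'.2 ?_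
      rw [Ideal.radical_eq_sInf, Submodule.mem_sInf]
      rintro P ⟨hP, hPp⟩
      have hmem : (⟨P, hPp⟩ : PrimeSpectrum R) ∈ Module.support R (QuotSMulTop a B) := by
        rw [Module.support_quotSMulTop, Module.support_eq_zeroLocus]
        refine ⟨fun x hx => hP (Ideal.mem_sup_left hx), ?_⟩
        intro x hx
        exact hP (Ideal.mem_sup_right (Ideal.subset_span hx))
      rw [← Module.supportDim_eq_of_equiv eB] at hf0
      have hnt2 : Nontrivial (QuotSMulTop a B) := by
        rw [← not_subsingleton_iff_nontrivial, ← Module.support_eq_empty_iff (R := R)]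
        exact Set.Nonempty.ne_empty ⟨_, hmem⟩
      have h0 : Module.supportDim R (QuotSMulTop a B) = 0 :=
        le_antisymm hf0 (Order.krullDim_nonneg_iff.mpr ⟨⟨_, hmem⟩⟩)
      rw [support_of_supportDim_eq_zero _ _ h0] at hmem
      exact hmem hum
    refine IsLocalRing.isWeaklyRegular_of_perm_of_subset_maximalIdeal (rs := fs ++ [a]) ?_
        (by simpa using (List.perm_append_comm (l₁ := fs) (l₂ := [a]))) ?_
    · rw [isWeaklyRegular_append_iff, isWeaklyRegular_singleton_iff]
      exact ⟨huf'.1, haB⟩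
    · intro r hr
      rw [List.mem_append, List.mem_singleton] at hr
      rcases hr with hr | rfl
      · exact hfm' r hr
      · exact ham


section hilb
variable {F : Type*} [Field F] {n : ℕ}

/-- degree `m` part of an ideal -/
def degPart (I : Ideal (MvPolynomial (Fin n) F)) (m : ℕ) : Submodule F (MvPolynomial (Fin n) F) :=
  homogeneousSubmodule (Fin n) F m ⊓ I.restrictScalars F

instance finite_homSub (m : ℕ) : Module.Finite F (homogeneousSubmodule (Fin n) F m) := by
  refine Submodule.finiteDimensional_of_le (S₂ := restrictTotalDegree (Fin n) F m) ?_
  intro p hp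
  rw [mem_restrictTotalDegree]
  exact IsHomogeneous.totalDegree_le hp

lemma finite_degPart (I : Ideal (MvPolynomial (Fin n) F)) (m : ℕ) :
    Module.Finite F (degPart I m) :=
  Submodule.finiteDimensional_of_le
    (inf_le_left : degPart I m ≤ homogeneousSubmodule (Fin n) F m)

lemma my_finrank_map {V W : Type*} [AddCommGroup V] [Module F V] [AddCommGroup W] [Module F W]
    {φ : V →ₗ[F] W} (h : Function.Injective φ) (p : Submodule F V) :
    Module.finrank F (p.map φ) = Module.finrank F p :=
  (Submodule.equivMapOfInjective φ h p).finrank_eq.symm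

lemma comp_mul_aux {f q : MvPolynomial (Fin n) F} {d m : ℕ} (hf : f.IsHomogeneous d) :
    homogeneousComponent m (f * q) =
      ∑ i ∈ Finset.range (q.totalDegree + 1),
        if m = d + i then f * homogeneousComponent i q else 0 := by
  conv_lhs => rw [← sum_homogeneousComponent q, Finset.mul_sum, map_sum]
  refine Finset.sum_congr rfl fun i _ => ?_
  exact homogeneousComponent_of_mem (hf.mul (homogeneousComponent_isHomogeneous _ _))

lemma comp_mul_le {f q : MvPolynomial (Fin n) F} {d m : ℕ} (hf : f.IsHomogeneous d) (h : d ≤ m) :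
    homogeneousComponent m (f * q) = f * homogeneousComponent (m - d) q := by
  obtain ⟨k, rfl⟩ := Nat.exists_eq_add_of_le h
  rw [comp_mul_aux hf]
  simp only [add_right_inj, add_tsub_cancel_left, Finset.sum_ite_eq, Finset.mem_range]
  split_ifs with hk
  · rfl
  · rw [homogeneousComponent_eq_zero _ _ (by omega), mul_zero]

lemma comp_mul_not_le {f q : MvPolynomial (Fin n) F} {d m : ℕ} (hf : f.IsHomogeneous d)
    (h : ¬ d ≤ m) :
    homogeneousComponent m (f * q) = 0 := by
  rw [comp_mul_aux hf]
  refine Finset.sum_eq_zero fun i _ => if_neg (by omega)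

/-- An ideal closed under homogeneous components. -/
def HomIdeal (I : Ideal (MvPolynomial (Fin n) F)) : Prop :=
  ∀ p ∈ I, ∀ m, homogeneousComponent m p ∈ I

lemma homIdeal_span {s : Set (MvPolynomial (Fin n) F)} (hs : ∀ f ∈ s, ∃ d, f.IsHomogeneous d) :
    HomIdeal (Ideal.span s) := by
  intro p hp m
  let _ := gradedAlgebra (σ := Fin n) (R := F)
  refine homogeneousComponent_mem_of_mem ?_ hp m
  exact Ideal.homogeneous_span (homogeneousSubmodule (Fin n) F) s
    (fun x hx => by obtain ⟨d, hd⟩ := hs x hx; exact ⟨d, hd⟩)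

lemma degPart_sup_lt (I : Ideal (MvPolynomial (Fin n) F)) (hI : HomIdeal I)
    {f : MvPolynomial (Fin n) F} {d m : ℕ} (hf : f.IsHomogeneous d) (h : ¬ d ≤ m) :
    degPart (I ⊔ Ideal.span {f}) m = degPart I m := by
  apply le_antisymm
  · rintro p ⟨hp1, hp2⟩
    refine ⟨hp1, ?_⟩
    obtain ⟨i, hi, j, hj, e⟩ := Submodule.mem_sup.mp (show p ∈ I ⊔ Ideal.span {f} from hp2)
    obtain ⟨q, rfl⟩ := Ideal.mem_span_singleton.mp hj
    have e2 := congrArg (homogeneousComponent m) e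
    rw [map_add, comp_mul_not_le hf h, homogeneousComponent_of_mem hp1] at e2
    simp only [if_true, add_zero] at e2
    change p ∈ I
    rw [← e2]
    exact hI _ hi _
  · exact inf_le_inf_left _ (show I ≤ I ⊔ Ideal.span {f} from le_sup_left)

lemma degPart_sup_add (I : Ideal (MvPolynomial (Fin n) F)) (hI : HomIdeal I)
    {f : MvPolynomial (Fin n) F} {d : ℕ} (hf : f.IsHomogeneous d) (hf0 : f ≠ 0) (m : ℕ)
    (hreg : ∀ s : MvPolynomial (Fin n) F, s.IsHomogeneous m → f * s ∈ I → s ∈ I) :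
    Module.finrank F (degPart (I ⊔ Ideal.span {f}) (d + m)) + Module.finrank F (degPart I m)
     = Module.finrank F (degPart I (d + m)) +
      Module.finrank F (homogeneousSubmodule (Fin n) F m) := by
  have hinj : Function.Injective (LinearMap.mulLeft F f) := by
    intro a b hab
    exact mul_left_cancel₀ hf0 hab
  have e1 : degPart (I ⊔ Ideal.span {f}) (d + m) = degPart I (d + m) ⊔
      (homogeneousSubmodule (Fin n) F m).map (LinearMap.mulLeft F f) := by
    apply le_antisymm
    · rintro p ⟨hp1, hp2⟩
      obtain ⟨i, hi, j, hj, e⟩ := Submodule.mem_sup.mp (show p ∈ I ⊔ Ideal.span {f} from hp2)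
      obtain ⟨q, rfl⟩ := Ideal.mem_span_singleton.mp hj
      have e2 := congrArg (homogeneousComponent (d + m)) e
      rw [map_add, comp_mul_le hf (by omega), homogeneousComponent_of_mem hp1] at e2
      simp only [if_true, add_tsub_cancel_left] at e2
      rw [← e2]
      refine Submodule.add_mem_sup ⟨homogeneousComponent_isHomogeneous _ _, hI _ hi _⟩
        ⟨_, homogeneousComponent_isHomogeneous _ _, rfl⟩
    · refine sup_le (inf_le_inf_left _ (show I ≤ I ⊔ Ideal.span {f} from le_sup_left)) ?_
      rintro _ ⟨q, hq, rfl⟩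
      refine ⟨hf.mul hq, ?_⟩
      exact Ideal.mul_mem_right _ _ (Ideal.mem_sup_right (Ideal.mem_span_singleton_self f))
  have e2 : (degPart I m).map (LinearMap.mulLeft F f) = degPart I (d + m) ⊓
      (homogeneousSubmodule (Fin n) F m).map (LinearMap.mulLeft F f) := by
    apply le_antisymm
    · rintro _ ⟨q, ⟨hq1, hq2⟩, rfl⟩
      exact ⟨⟨hf.mul hq1, I.mul_mem_left f hq2⟩, ⟨q, hq1, rfl⟩⟩
    · rintro _ ⟨⟨h1, h2⟩, ⟨q, hq, rfl⟩⟩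
      exact ⟨q, ⟨hq, hreg q hq h2⟩, rfl⟩
  have := finite_degPart I (d + m)
  have h := Submodule.finrank_sup_add_finrank_inf_eq (degPart I (d + m))
      ((homogeneousSubmodule (Fin n) F m).map (LinearMap.mulLeft F f))
  rw [← e1, ← e2] at h
  rwa [my_finrank_map hinj, my_finrank_map hinj] at h

/-- Hilbert series of the quotient by `I`. -/
def hilb (I : Ideal (MvPolynomial (Fin n) F)) : PowerSeries ℤ :=
  PowerSeries.mk fun m => (Module.finrank F (homogeneousSubmodule (Fin n) F m) : ℤ) -
    Module.finrank F (degPart I m)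

lemma hilb_sup (I : Ideal (MvPolynomial (Fin n) F)) (hI : HomIdeal I)
    {f : MvPolynomial (Fin n) F} {d : ℕ} (hf : f.IsHomogeneous d) (hf0 : f ≠ 0)
    (hreg : ∀ m, ∀ s : MvPolynomial (Fin n) F, s.IsHomogeneous m → f * s ∈ I → s ∈ I) :
    hilb (I ⊔ Ideal.span {f}) = hilb I * (1 - PowerSeries.X ^ d) := by
  ext m
  rw [mul_sub, mul_one, map_sub, PowerSeries.coeff_mul_X_pow']
  split_ifs with h
  · obtain ⟨k, rfl⟩ := Nat.exists_eq_add_of_le h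
    have := degPart_sup_add I hI hf hf0 k (hreg k)
    simp only [hilb, PowerSeries.coeff_mk, add_tsub_cancel_left]
    omega
  · simp only [hilb, PowerSeries.coeff_mk, sub_zero]
    rw [degPart_sup_lt I hI hf h]

lemma hilb_seq (f : Fin n → MvPolynomial (Fin n) F) (d : Fin n → ℕ)
    (hhom : ∀ i, (f i).IsHomogeneous (d i)) (hne : ∀ i, f i ≠ 0)
    (hreg : ∀ i m, ∀ s : MvPolynomial (Fin n) F, s.IsHomogeneous m →
      f i * s ∈ Ideal.span (f '' {j | j < i}) → s ∈ Ideal.span (f '' {j | j < i})) :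
    hilb (Ideal.span (Set.range f)) =
      hilb (⊥ : Ideal (MvPolynomial (Fin n) F)) * ∏ i, (1 - PowerSeries.X ^ d i) := by
  have key : ∀ k ≤ n, hilb (Ideal.span (f '' {j | j.val < k})) =
      hilb (⊥ : Ideal (MvPolynomial (Fin n) F)) *
        ∏ i with i.val < k, (1 - PowerSeries.X ^ d i) := by
    intro k
    induction k with
    | zero => intro _; simp
    | succ k ih =>
      intro hk
      have e : {j : Fin n | j.val < k + 1} = {j : Fin n | j.val < k} ∪ {⟨k, hk⟩} := by
        ext j; simp [Fin.ext_iff]; omega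
      have e' : (Finset.univ.filter fun j : Fin n => j.val < k + 1) =
          insert ⟨k, hk⟩ (Finset.univ.filter fun j : Fin n => j.val < k) := by
        ext j; simp [Fin.ext_iff]; omega
      rw [e, Set.image_union, Set.image_singleton, Ideal.span_union, hilb_sup _ _ (hhom ⟨k, hk⟩)
        (hne _), ih (by omega), e', Finset.prod_insert (by simp)]
      · ring
      · exact hreg ⟨k, hk⟩
      · apply homIdeal_span
        rintro _ ⟨j, _, rfl⟩
        exact ⟨_, hhom j⟩
  have := key n le_rfl
  simpa using this

lemma hilb_X : hilb (Ideal.span (Set.range (X : Fin n → MvPolynomial (Fin n) F))) = 1 := by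
  ext m
  rw [hilb, PowerSeries.coeff_mk, PowerSeries.coeff_one]
  split_ifs with h
  · subst h
    have h0 : degPart (Ideal.span (Set.range (X : Fin n → MvPolynomial (Fin n) F))) 0 = ⊥ := by
      rw [eq_bot_iff]
      rintro p ⟨h1, h2⟩
      rw [SetLike.mem_coe, homogeneousSubmodule_zero, Submodule.mem_one] at h1
      obtain ⟨c, rfl⟩ := h1
      have h3 : Ideal.span (Set.range (X : Fin n → MvPolynomial (Fin n) F)) ≤
          RingHom.ker (constantCoeff) := by
        rw [Ideal.span_le]; rintro _ ⟨i, rfl⟩; simp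
      have h4 := h3 h2
      simp [algebraMap_eq] at h4
      simp [h4]
    have h1 : Module.finrank F (homogeneousSubmodule (Fin n) F 0) = 1 := by
      rw [homogeneousSubmodule_zero, Submodule.one_eq_span]
      exact finrank_span_singleton one_ne_zero
    rw [h0, h1]; simp
  · have : degPart (Ideal.span (Set.range (X : Fin n → MvPolynomial (Fin n) F))) m =
      homogeneousSubmodule (Fin n) F m := by
      refine le_antisymm inf_le_left (fun p hp => ⟨hp, ?_⟩)
      change p ∈ Ideal.span (Set.range (X : Fin n → MvPolynomial (Fin n) F))
      rw [← Set.image_univ, mem_ideal_span_X_image]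
      intro s hs
      by_contra! hcon
      have : s = 0 := by ext i; simpa using hcon i
      have h2 := hp (mem_support_iff.mp hs)
      rw [this] at h2
      simp at h2
      exact h h2.symm
    rw [this, sub_self]

lemma X_reg (i : Fin n) (s : MvPolynomial (Fin n) F)
    (h : X i * s ∈ Ideal.span ((X : Fin n → MvPolynomial (Fin n) F) '' {j | j < i})) :
    s ∈ Ideal.span ((X : Fin n → MvPolynomial (Fin n) F) '' {j | j < i}) := by
  rw [mem_ideal_span_X_image] at h ⊢
  intro m hm
  obtain ⟨j, hj, hj2⟩ := h (Finsupp.single i 1 + m) (by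
    rw [mem_support_iff] at hm ⊢
    rwa [coeff_X_mul])
  refine ⟨j, hj, ?_⟩
  have : i ≠ j := (ne_of_lt hj).symm
  simpa [Finsupp.single_apply, this] using hj2

lemma hilb_eq (f : Fin n → MvPolynomial (Fin n) F) (d : Fin n → ℕ)
    (hhom : ∀ i, (f i).IsHomogeneous (d i)) (hne : ∀ i, f i ≠ 0)
    (hreg : ∀ i m, ∀ s : MvPolynomial (Fin n) F, s.IsHomogeneous m →
      f i * s ∈ Ideal.span (f '' {j | j < i}) → s ∈ Ideal.span (f '' {j | j < i})) :
    hilb (Ideal.span (Set.range f)) =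
      ((∏ i, ∑ k ∈ Finset.range (d i), (Polynomial.X : Polynomial ℤ) ^ k : Polynomial ℤ) :
        PowerSeries ℤ) := by
  have h1 := hilb_seq f d hhom hne hreg
  have h2 := hilb_seq (F := F) (n := n) X (fun _ => 1) (fun i => isHomogeneous_X _ _)
    (fun i => X_ne_zero _) (fun i _ s _ h => X_reg i s h)
  rw [hilb_X] at h2
  have h3 : ∏ i, (1 - (PowerSeries.X : PowerSeries ℤ) ^ d i) =
      ((∏ i, ∑ k ∈ Finset.range (d i), (Polynomial.X : Polynomial ℤ) ^ k : Polynomial ℤ) :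
        PowerSeries ℤ) * ∏ i : Fin n, (1 - (PowerSeries.X : PowerSeries ℤ) ^ 1) := by
    rw [← Polynomial.coeToPowerSeries.ringHom_apply, map_prod, ← Finset.prod_mul_distrib]
    refine Finset.prod_congr rfl fun i _ => ?_
    rw [map_sum]
    simp only [map_pow, Polynomial.coeToPowerSeries.ringHom_apply, Polynomial.coe_X, pow_one]
    exact (geom_sum_mul_neg _ _).symm
  rw [h1, h3, mul_left_comm, ← h2, mul_one]

lemma finrank_le_of_hilb (I : Ideal (MvPolynomial (Fin n) F)) (P : Polynomial ℤ)
    (hP : hilb I = (P : PowerSeries ℤ)) [Module.Finite F (MvPolynomial (Fin n) F ⧸ I)] :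
    (Module.finrank F (MvPolynomial (Fin n) F ⧸ I) : ℤ) ≤ P.eval 1 := by
  let π : MvPolynomial (Fin n) F →ₗ[F] (MvPolynomial (Fin n) F ⧸ I) := (Ideal.Quotient.mkₐ F I).toLinearMap
  have hrank : ∀ m, (Module.finrank F ((homogeneousSubmodule (Fin n) F m).map π) : ℤ)
      = P.coeff m := by
    intro m
    have h1 := congrArg (PowerSeries.coeff m) hP
    rw [Polynomial.coeff_coe, hilb, PowerSeries.coeff_mk] at h1
    have h2 := LinearMap.finrank_range_add_finrank_ker
      (π.domRestrict (homogeneousSubmodule (Fin n) F m))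
    have h3 : Module.finrank F (LinearMap.ker (π.domRestrict (homogeneousSubmodule (Fin n) F m)))
        = Module.finrank F (degPart I m) := by
      rw [← my_finrank_map
        (homogeneousSubmodule (Fin n) F m).injective_subtype]
      have : Submodule.map (homogeneousSubmodule (Fin n) F m).subtype
        (LinearMap.ker (π.domRestrict (homogeneousSubmodule (Fin n) F m))) = degPart I m := by
        ext p
        constructor
        · rintro ⟨q, hq, rfl⟩
          exact ⟨q.2, Ideal.Quotient.eq_zero_iff_mem.mp hq⟩
        · rintro ⟨h, h'⟩
          exact ⟨⟨p, h⟩, Ideal.Quotient.eq_zero_iff_mem.mpr h', rfl⟩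
      rw [this]
    rw [h3, LinearMap.range_domRestrict] at h2
    rw [← h1, ← h2]; push_cast; ring
  have hle : ∀ s : Finset ℕ, (Module.finrank F
      (s.sup fun m => (homogeneousSubmodule (Fin n) F m).map π : Submodule F _) : ℤ)
      ≤ ∑ m ∈ s, P.coeff m := by
    intro s
    induction s using Finset.induction_on with
    | empty => simp
    | insert a s ha ih =>
      rw [Finset.sup_insert, Finset.sum_insert ha, ← hrank a]
      refine le_trans ?_ (add_le_add_right ih _)
      exact_mod_cast Submodule.finrank_add_le_finrank_add_finrank _ _
  have htop : (Finset.range (P.natDegree + 1)).sup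
      (fun m => (homogeneousSubmodule (Fin n) F m).map π) = ⊤ := by
    rw [eq_top_iff]
    rintro x -
    obtain ⟨p, rfl⟩ := Ideal.Quotient.mk_surjective x
    change π p ∈ _
    rw [← sum_homogeneousComponent p, map_sum]
    refine Submodule.sum_mem _ fun m _ => ?_
    have hm : π (homogeneousComponent m p) ∈ (homogeneousSubmodule (Fin n) F m).map π :=
      ⟨_, homogeneousComponent_isHomogeneous _ _, rfl⟩
    by_cases h : m < P.natDegree + 1
    · exact Finset.le_sup (f := fun m => (homogeneousSubmodule (Fin n) F m).map π)
        (Finset.mem_range.mpr h) hm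
    · have h0 := hrank m
      rw [Polynomial.coeff_eq_zero_of_natDegree_lt (by omega)] at h0
      have : (homogeneousSubmodule (Fin n) F m).map π = ⊥ :=
        Submodule.finrank_eq_zero.mp (by exact_mod_cast h0)
      rw [this, Submodule.mem_bot] at hm
      rw [hm]; exact Submodule.zero_mem _
  have := hle (Finset.range (P.natDegree + 1))
  rw [htop, finrank_top] at this
  rw [Polynomial.eval_eq_sum_range]
  simpa using this

end hilb

section part3
variable {F : Type*} [Field F] {n : ℕ}

lemma ofList_take_ofFn {S : Type*} [CommRing S] (f : Fin n → S) (i : Fin n) :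
    Ideal.ofList (List.take i.val (List.ofFn f)) = Ideal.span (f '' {j | j < i}) := by
  unfold Ideal.ofList
  congr 1
  ext x
  simp only [Set.mem_ofPred_eq, Set.mem_image, List.mem_take_iff_getElem, List.getElem_ofFn,
    List.length_ofFn]
  constructor
  · rintro ⟨j, hj, rfl⟩
    exact ⟨⟨j, by omega⟩, by simp only [Fin.lt_def]; omega, rfl⟩
  · rintro ⟨j, hj, rfl⟩
    exact ⟨j.val, by have := Fin.lt_def.mp hj; omega, rfl⟩

lemma ofList_ofFn {S : Type*} [CommRing S] (f : Fin n → S) :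
    Ideal.ofList (List.ofFn f) = Ideal.span (Set.range f) := by
  unfold Ideal.ofList
  congr 1
  ext x
  simp

lemma weaklyRegular_ofFn_iff {S : Type*} [CommRing S] (f : Fin n → S) :
    IsWeaklyRegular S (List.ofFn f) ↔ ∀ (i : Fin n) (s : S),
      f i * s ∈ Ideal.span (f '' {j | j < i}) → s ∈ Ideal.span (f '' {j | j < i}) := by
  rw [isWeaklyRegular_iff]
  constructor
  · intro h i s hs
    have h1 := h i.val (by simp)
    rw [isSMulRegular_quotient_iff_mem_of_smul_mem, ofList_take_ofFn] at h1
    simpa using h1 s (by simpa using hs)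
  · intro h i hi
    rw [List.length_ofFn] at hi
    rw [isSMulRegular_quotient_iff_mem_of_smul_mem]
    intro s hs
    have := ofList_take_ofFn f ⟨i, hi⟩
    simp only at this
    rw [this] at hs ⊢
    simpa using h ⟨i, hi⟩ s (by simpa using hs)

lemma finite_quot (f : Fin n → MvPolynomial (Fin n) F)
    (hfin : Module.Finite (Algebra.adjoin F (Set.range f)) (MvPolynomial (Fin n) F)) :
    Module.Finite F (MvPolynomial (Fin n) F ⧸ Ideal.span (Set.range f)) := by
  obtain ⟨s, hs⟩ := hfin.fg_top
  let π := Ideal.Quotient.mkₐ F (Ideal.span (Set.range f))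
  have hA : Algebra.adjoin F (Set.range f) ≤ (⊥ : Subalgebra F _).comap π := by
    refine Algebra.adjoin_le ?_
    rintro _ ⟨i, rfl⟩
    have : π (f i) = 0 := Ideal.Quotient.eq_zero_iff_mem.mpr (Ideal.subset_span ⟨i, rfl⟩)
    change π (f i) ∈ (⊥ : Subalgebra F _)
    rw [this]; exact zero_mem _
  classical
  refine ⟨⟨s.image π, ?_⟩⟩
  rw [eq_top_iff]
  rintro x -
  obtain ⟨p, rfl⟩ := Ideal.Quotient.mk_surjective x
  change π p ∈ _
  have hp : p ∈ Submodule.span (Algebra.adjoin F (Set.range f))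
    (s : Set (MvPolynomial (Fin n) F)) := by rw [hs]; trivial
  induction hp using Submodule.span_induction with
  | mem x hx => exact Submodule.subset_span (by simpa using ⟨x, hx, rfl⟩)
  | zero => rw [map_zero]; exact zero_mem _
  | add x y _ _ hx hy => rw [map_add]; exact add_mem hx hy
  | smul a x _ hx =>
    obtain ⟨c, hc⟩ := Algebra.mem_bot.mp (hA a.2)
    have : π (a • x) = c • π x := by
      refine Eq.trans ?_ (Algebra.smul_def c (π x)).symm
      rw [hc]
      exact map_mul π a.1 x
    rw [this]
    exact Submodule.smul_mem _ _ hx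

/-- The irrelevant ideal. -/
def irr (F : Type*) [Field F] (n : ℕ) : Ideal (MvPolynomial (Fin n) F) :=
  RingHom.ker (constantCoeff (σ := Fin n) (R := F))

instance irr_prime : (irr F n).IsPrime := RingHom.ker_isPrime _

lemma irr_eq : irr F n = Ideal.span (Set.range X) := by
  apply le_antisymm
  · intro p hp
    rw [← Set.image_univ, mem_ideal_span_X_image]
    intro s hs
    by_contra! hcon
    have h0 : s = 0 := by ext i; simpa using hcon i
    rw [h0, mem_support_iff] at hs
    exact hs hp
  · rw [Ideal.span_le]
    rintro _ ⟨i, rfl⟩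
    simp [irr]

lemma dim_loc : IsRegular (Localization.AtPrime (irr F n))
      ((List.ofFn (X : Fin n → MvPolynomial (Fin n) F)).map
        (algebraMap _ (Localization.AtPrime (irr F n)))) ∧
    Module.supportDim (Localization.AtPrime (irr F n)) (Localization.AtPrime (irr F n)) = n := by
  have h1 : IsWeaklyRegular (MvPolynomial (Fin n) F)
      (List.ofFn (X : Fin n → MvPolynomial (Fin n) F)) :=
    (weaklyRegular_ofFn_iff _).mpr X_reg
  have h2 := IsWeaklyRegular.of_isLocalization (Localization.AtPrime (irr F n))
    (irr F n).primeCompl h1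
  have h3 : Ideal.ofList ((List.ofFn (X : Fin n → MvPolynomial (Fin n) F)).map
        (algebraMap _ (Localization.AtPrime (irr F n)))) =
        IsLocalRing.maximalIdeal (Localization.AtPrime (irr F n)) := by
    rw [← Ideal.map_ofList, ofList_ofFn, ← irr_eq, Localization.AtPrime.map_eq_maximalIdeal]
  have h4 : IsRegular (Localization.AtPrime (irr F n)) _ :=
    IsRegular.of_isWeaklyRegular_of_mem_maximalIdeal _ (by
      intro r hr
      rw [← h3]
      exact Ideal.subset_span hr) h2
  refine ⟨h4, ?_⟩
  have h5 := ringKrullDim_add_length_eq_ringKrullDim_of_isRegular _ h4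
  rw [h3, List.length_map, List.length_ofFn] at h5
  have h6 : ringKrullDim (Localization.AtPrime (irr F n) ⧸
      IsLocalRing.maximalIdeal (Localization.AtPrime (irr F n))) = 0 :=
    ringKrullDim_eq_zero_of_field (IsLocalRing.ResidueField (Localization.AtPrime (irr F n)))
  rw [h6, zero_add] at h5
  rw [Module.supportDim_self_eq_ringKrullDim, ← h5]

lemma hsop_reg (f : Fin n → MvPolynomial (Fin n) F)
    (hf0 : ∀ i, f i ∈ irr F n)
    [Module.Finite F (MvPolynomial (Fin n) F ⧸ Ideal.span (Set.range f))] :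
    IsWeaklyRegular (Localization.AtPrime (irr F n))
      ((List.ofFn f).map (algebraMap _ (Localization.AtPrime (irr F n)))) := by
  obtain ⟨h1, h2⟩ := dim_loc (F := F) (n := n)
  refine isWeaklyRegular_of_sop n _ _ _ (by simp) (by simp) ?_ h1 h2 ?_
  · intro r hr
    simp only [List.mem_map, List.mem_ofFn] at hr
    obtain ⟨_, ⟨i, rfl⟩, rfl⟩ := hr
    rw [← Localization.AtPrime.map_eq_maximalIdeal]
    exact Ideal.mem_map_of_mem _ (hf0 i)
  · rw [Module.supportDim, Order.krullDim_nonpos_iff_forall_isMax]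
    have key : ∀ P ∈ Module.support (Localization.AtPrime (irr F n))
        (Localization.AtPrime (irr F n) ⧸ (Ideal.ofList ((List.ofFn f).map
          (algebraMap _ (Localization.AtPrime (irr F n)))) • ⊤ :
          Ideal (Localization.AtPrime (irr F n)))),
        P.asIdeal = IsLocalRing.maximalIdeal _ := by
      intro P hP
      rw [Module.support_eq_zeroLocus, Ideal.annihilator_quotient, PrimeSpectrum.mem_zeroLocus,
        ← Ideal.map_ofList, ofList_ofFn] at hP
      have hP' : Ideal.span (Set.range f) ≤
          P.asIdeal.comap (algebraMap _ (Localization.AtPrime (irr F n))) := by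
        rw [← Ideal.map_le_iff_le_comap]
        simpa using hP
      have hle : P.asIdeal.comap (algebraMap _ (Localization.AtPrime (irr F n))) ≤ irr F n := by
        refine le_trans ?_ (Localization.AtPrime.under_maximalIdeal (I := irr F n)).le
        exact Ideal.comap_mono (IsLocalRing.le_maximalIdeal P.2.ne_top)
      have hmax : (P.asIdeal.comap (algebraMap (MvPolynomial (Fin n) F)
          (Localization.AtPrime (irr F n)))).IsMaximal := by
        set p := P.asIdeal.comap (algebraMap (MvPolynomial (Fin n) F)
          (Localization.AtPrime (irr F n))) with hp
        have hpp : p.IsPrime := Ideal.comap_isPrime _ _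
        have : Module.Finite F (MvPolynomial (Fin n) F ⧸ p) :=
          Module.Finite.of_surjective (Ideal.Quotient.factorₐ F hP').toLinearMap
            (Ideal.Quotient.factor_surjective hP')
        exact Ideal.Quotient.maximal_of_isField _ (isField_of_isIntegral_of_isField'
          (R := F) (Field.toIsField F))
      have heq := hmax.eq_of_le irr_prime.ne_top hle
      rw [← Localization.AtPrime.map_eq_maximalIdeal]
      refine Eq.trans ?_ (congrArg (Ideal.map (algebraMap (MvPolynomial (Fin n) F)
          (Localization.AtPrime (irr F n)))) heq)
      exact (IsLocalization.map_comap (irr F n).primeCompl _ _).symm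
    intro x y hxy
    have := key x.1 x.2
    have := key y.1 y.2
    change y.1.asIdeal ≤ x.1.asIdeal
    simp [*]

lemma hsop_reg' (f : Fin n → MvPolynomial (Fin n) F) (d : Fin n → ℕ)
    (hhom : ∀ i, (f i).IsHomogeneous (d i)) (hf0 : ∀ i, f i ∈ irr F n)
    [Module.Finite F (MvPolynomial (Fin n) F ⧸ Ideal.span (Set.range f))]
    (i : Fin n) (m : ℕ) (s : MvPolynomial (Fin n) F) (hs : s.IsHomogeneous m)
    (h : f i * s ∈ Ideal.span (f '' {j | j < i})) : s ∈ Ideal.span (f '' {j | j < i}) := by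
  have h1 := hsop_reg f hf0
  rw [List.map_ofFn, weaklyRegular_ofFn_iff] at h1
  have e : Ideal.span ((algebraMap (MvPolynomial (Fin n) F) (Localization.AtPrime (irr F n)) ∘ f)
      '' {j | j < i}) = (Ideal.span (f '' {j | j < i})).map (algebraMap _ _) := by
    rw [Ideal.map_span, Set.image_comp]
  have h2 := h1 i (algebraMap _ _ s) (by
    rw [e, Function.comp_apply, ← map_mul]
    exact Ideal.mem_map_of_mem _ h)
  rw [e, IsLocalization.algebraMap_mem_map_algebraMap_iff (irr F n).primeCompl] at h2
  obtain ⟨t, ht, hts⟩ := h2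
  have hI : HomIdeal (Ideal.span (f '' {j | j < i})) := by
    apply homIdeal_span
    rintro _ ⟨j, _, rfl⟩
    exact ⟨_, hhom j⟩
  have h3 := hI _ hts m
  rw [mul_comm, comp_mul_le hs le_rfl, Nat.sub_self, homogeneousComponent_zero] at h3
  have hc : coeff 0 t ≠ 0 := fun h0 => ht h0
  have h4 := Ideal.mul_mem_right (C (coeff 0 t)⁻¹) _ h3
  rwa [mul_assoc, ← C_mul, mul_inv_cancel₀ hc, C_1, mul_one] at h4

end part3

end helpers

/-- If `f₁,…,fₙ` is a homogeneous system of parameters of `F[V]^G` with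
`deg fᵢ = dᵢ`, then the coinvariant ring `F[V]_G` is a finite-dimensional `F`-vector space of
dimension at most `d₁⋯dₙ`. -/
theorem dim_coinvariants_le_of_hsop
    {F : Type*} [Field F] {n : ℕ} {G : Type*} [Group G] [Finite G]
    (φ : G →* (MvPolynomial (Fin n) F ≃ₐ[F] MvPolynomial (Fin n) F))
    (hlin : ∀ (g : G) (i : Fin n), ((φ g) (X i)).IsHomogeneous 1)
    (f : Fin n → MvPolynomial (Fin n) F) (d : Fin n → ℕ)
    (hhom : ∀ i, (f i).IsHomogeneous (d i)) (hdpos : ∀ i, 0 < d i)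
    (hinv : ∀ (i : Fin n) (g : G), φ g (f i) = f i)
    (hfin : Module.Finite (Algebra.adjoin F (Set.range f)) (MvPolynomial (Fin n) F)) :
    Module.Finite F (MvPolynomial (Fin n) F ⧸ hilbertIdealOf φ) ∧
    Module.finrank F (MvPolynomial (Fin n) F ⧸ hilbertIdealOf φ) ≤ ∏ i, d i := by
  have hf0 : ∀ i, constantCoeff (f i) = 0 := by
    intro i
    by_contra hcon
    have h1 := hhom i (d := 0) hcon
    have h2 := hdpos i
    simp at h1
    omega
  have hfinq := finite_quot f hfin
  have hle : Ideal.span (Set.range f) ≤ hilbertIdealOf φ := by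
    refine Ideal.span_mono ?_
    rintro _ ⟨i, rfl⟩
    exact ⟨hinv i, hf0 i⟩
  have hsurj : Function.Surjective (Ideal.Quotient.factorₐ F hle).toLinearMap :=
    Ideal.Quotient.factor_surjective hle
  refine ⟨Module.Finite.of_surjective _ hsurj, ?_⟩
  refine (LinearMap.finrank_le_finrank_of_surjective hsurj).trans ?_
  have hreg := hsop_reg' f d hhom hf0
  have hne : ∀ i, f i ≠ 0 := by
    intro i h0
    have h1 := hreg i 0 1 (isHomogeneous_one _ _) (by rw [h0, zero_mul]; exact zero_mem _)
    have h2 : Ideal.span (f '' {j | j < i}) ≤ irr F n := by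
      rw [Ideal.span_le]
      rintro _ ⟨j, _, rfl⟩
      exact hf0 j
    exact irr_prime.ne_top ((Ideal.eq_top_iff_one _).mpr (h2 h1))
  have := finrank_le_of_hilb _ _ (hilb_eq f d hhom hne hreg)
  rw [Polynomial.eval_prod] at this
  simp only [Polynomial.eval_finsetSum, Polynomial.eval_pow, Polynomial.eval_X, one_pow,
    Finset.sum_const, Finset.card_range, nsmul_eq_mul, mul_one] at this
  exact_mod_cast this
end
end
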